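/- arXiv:math/0611425 — 2 statements merged into one kernel-verified Lean document; each statement's English description precedes it below -/
import Mathlib

section
/- Let n ≥ 2, a ≥ 1 and let k ≥ 1 be an integer. There is a constant C_k, depending only on n, a and k, such that for every ε ∈ (0,1) and all x, y in the closed upper half-space with x ≠ y, the weighted derivative bound x_n · ‖D_x^k E^ε(x,y)‖ ≤ C_k |x − y|^{2−n−k} holds. -/
open MeasureTheory


open MeasureTheory

/-- `A(x,y,θ) = (θ D(x,y)² + (1−θ) Ď(x,y)²)^{1/2}`, where `D(x,y)² = |x−y|²` and
`Ď(x,y)² = |x−y|² − (xₙ−yₙ)² + (xₙ+yₙ)² ( = |x'−y'|² + (xₙ+yₙ)²)`,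
the `n`-th coordinate being the coordinate `i`. -/
noncomputable def greenA {n : ℕ} (i : Fin n) (x y : EuclideanSpace ℝ (Fin n)) (θ : ℝ) : ℝ :=
  Real.sqrt (θ * ‖x - y‖ ^ 2 +
    (1 - θ) * (‖x - y‖ ^ 2 - (x i - y i) ^ 2 + (x i + y i) ^ 2))

/-- `F(x,y,θ) = yₙ^{a+1} A(x,y,θ)^{−(a+n)} (θ(1−θ))^{a/2}`. -/
noncomputable def greenF {n : ℕ} (a : ℝ) (i : Fin n)
    (x y : EuclideanSpace ℝ (Fin n)) (θ : ℝ) : ℝ :=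
  (y i) ^ (a + 1) * greenA i x y θ ^ (-(a + (n : ℝ))) * (θ * (1 - θ)) ^ (a / 2)

/-- The truncated Green kernel `E^ε(x,y) = ∫₀^{1−ε} F(x,y,θ) dθ`. -/
noncomputable def greenE {n : ℕ} (a : ℝ) (i : Fin n) (ε : ℝ)
    (x y : EuclideanSpace ℝ (Fin n)) : ℝ :=
  ∫ θ in (0 : ℝ)..(1 - ε), greenF a i x y θ

open scoped ContDiff Topology

section ParametricDerivatives

variable {P E F : Type*} [NormedAddCommGroup P] [NormedSpace ℝ P]
  [NormedAddCommGroup E] [NormedSpace ℝ E] [NormedAddCommGroup F] [NormedSpace ℝ F]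

/-- Iterated derivatives in one variable of a jointly smooth function are jointly smooth. -/
theorem contDiffAt_iteratedFDeriv_of_uncurry {f : P → E → F} {p : P × E}
    (hf : ContDiffAt ℝ ∞ (fun q : P × E => f q.1 q.2) p) (m : ℕ) :
    ContDiffAt ℝ ∞ (fun q : P × E => iteratedFDeriv ℝ m (f q.1) q.2) p := by
  induction m with
  | zero =>
    exact (continuousMultilinearCurryFin0 ℝ E F).symm.contDiff.contDiffAt.comp p hf
  | succ m ih =>
    have key : ContDiffAt ℝ ∞
        (fun q : P × E => fderiv ℝ (iteratedFDeriv ℝ m (f q.1)) q.2) p := by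
      refine ContDiffAt.fderiv (n := ∞)
        (f := fun (q : P × E) (y : E) => iteratedFDeriv ℝ m (f q.1) y) ?_ contDiffAt_snd le_rfl
      exact ContDiffAt.comp (f := fun z : (P × E) × E => (z.1.1, z.2)) (p, p.2) ih (by fun_prop)
    exact (continuousMultilinearCurryLeftEquiv ℝ (fun _ : Fin (m + 1) => E)
      F).symm.contDiff.contDiffAt.comp p key

/-- Differentiation under the integral sign, to any order. -/
theorem iteratedFDeriv_intervalIntegral [FiniteDimensional ℝ E] [CompleteSpace F]
    {g : ℝ → E → F} {a b : ℝ} (hab : a ≤ b) {U : Set E} (hU : IsOpen U)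
    (hg : ∀ t ∈ Set.Icc a b, ∀ x ∈ U, ContDiffAt ℝ ∞ (g t) x)
    (hc : ∀ m : ℕ, ContinuousOn (fun p : ℝ × E => iteratedFDeriv ℝ m (g p.1) p.2)
      (Set.Icc a b ×ˢ U)) (m : ℕ) {x : E} (hx : x ∈ U) :
    iteratedFDeriv ℝ m (fun x => ∫ t in a..b, g t x) x =
      ∫ t in a..b, iteratedFDeriv ℝ m (g t) x := by
  have : ProperSpace E := FiniteDimensional.proper ℝ E
  induction m generalizing x with
  | zero =>
    exact ((continuousMultilinearCurryFin0 ℝ E F).symm.toContinuousLinearEquiv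
      |>.toContinuousLinearMap.intervalIntegral_comp_comm (by
        have h0 := (continuousMultilinearCurryFin0 ℝ E F).continuous.comp_continuousOn (hc 0)
        refine ContinuousOn.intervalIntegrable ?_
        rw [Set.uIcc_of_le hab]
        exact h0.comp (f := fun t : ℝ => (t, x)) (by fun_prop) (fun t ht => ⟨ht, hx⟩))).symm
  | succ m ih =>
    have slice : ∀ (m : ℕ), ∀ y ∈ U,
        ContinuousOn (fun t => iteratedFDeriv ℝ m (g t) y) (Set.Icc a b) := fun m y hy =>
      (hc m).comp (f := fun t : ℝ => (t, y)) (by fun_prop) (fun t ht => ⟨ht, hy⟩)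
    let L : (E [×(m + 1)]→L[ℝ] F) ≃ₗᵢ[ℝ] (E →L[ℝ] E [×m]→L[ℝ] F) :=
      continuousMultilinearCurryLeftEquiv ℝ (fun _ : Fin (m + 1) => E) F
    obtain ⟨K, hKx, hKU, hK⟩ := local_compact_nhds (hU.mem_nhds hx)
    obtain ⟨C, hC⟩ := ((isCompact_Icc (a := a) (b := b)).prod hK).exists_bound_of_continuousOn
      ((hc (m + 1)).mono (Set.prod_mono_right hKU))
    have hae : ∀ p : ℝ → Prop, (∀ t ∈ Set.Icc a b, p t) →
        ∀ᵐ t ∂volume.restrict (Set.uIoc a b), p t := fun p hp => by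
      refine (ae_restrict_mem measurableSet_uIoc).mono fun t ht => hp t ?_
      rw [Set.uIoc_of_le hab] at ht
      exact Set.Ioc_subset_Icc_self ht
    have hsm : ∀ (m : ℕ), ∀ y ∈ U, AEStronglyMeasurable (fun t => iteratedFDeriv ℝ m (g t) y)
        (volume.restrict (Set.uIoc a b)) := fun m y hy => by
      rw [Set.uIoc_of_le hab]
      exact ((slice m y hy).aestronglyMeasurable_of_isCompact isCompact_Icc
        measurableSet_Icc).mono_set Set.Ioc_subset_Icc_self
    have hder : HasFDerivAt (fun y => ∫ t in a..b, iteratedFDeriv ℝ m (g t) y)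
        (∫ t in a..b, fderiv ℝ (iteratedFDeriv ℝ m (g t)) x) x := by
      refine hasFDerivAt_integral_of_dominated_of_fderiv_le'' (bound := fun _ => C)
        (F := fun y t => iteratedFDeriv ℝ m (g t) y)
        (F' := fun y t => fderiv ℝ (iteratedFDeriv ℝ m (g t)) y) hKx
        ?_ ?_ ?_ ?_ intervalIntegrable_const ?_
      · filter_upwards [hU.mem_nhds hx] with y hy using hsm m y hy
      · exact ContinuousOn.intervalIntegrable (by rw [Set.uIcc_of_le hab]; exact slice m x hx)
      · exact L.continuous.comp_aestronglyMeasurable (hsm (m + 1) x hx)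
      · refine hae _ fun t ht y hy => ?_
        rw [norm_fderiv_iteratedFDeriv]
        exact hC (t, y) ⟨ht, hy⟩
      · refine hae _ fun t ht y hy => ?_
        exact ((hg t ht y (hKU hy)).differentiableAt_iteratedFDeriv
          (by exact_mod_cast ENat.natCast_lt_top m)).hasFDerivAt
    have heq : iteratedFDeriv ℝ m (fun x => ∫ t in a..b, g t x) =ᶠ[𝓝 x]
        fun y => ∫ t in a..b, iteratedFDeriv ℝ m (g t) y := by
      filter_upwards [hU.mem_nhds hx] with y hy using ih hy
    rw [iteratedFDeriv_succ_eq_comp_left, Function.comp_apply, heq.fderiv_eq, hder.fderiv]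
    have hL : ∫ t in a..b, fderiv ℝ (iteratedFDeriv ℝ m (g t)) x =
        L (∫ t in a..b, iteratedFDeriv ℝ (m + 1) (g t) x) := by
      rw [intervalIntegral.integral_of_le hab, intervalIntegral.integral_of_le hab]
      exact ContinuousLinearEquiv.integral_comp_comm (𝕜 := ℝ) (F := E →L[ℝ] E [×m]→L[ℝ] F)
        L.toContinuousLinearEquiv (fun t => iteratedFDeriv ℝ (m + 1) (g t) x)
    rw [hL]
    exact L.symm_apply_apply _

end ParametricDerivatives

section RegularizedPower

variable {E : Type*} [NormedAddCommGroup E] [InnerProductSpace ℝ E]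

/-- The regularized power `(|q|² + c²)^{-m/2}`. -/
noncomputable def regPow (m c : ℝ) (q : E) : ℝ := Real.sqrt (‖q‖ ^ 2 + c ^ 2) ^ (-m)

theorem contDiffAt_regPow (m : ℝ) {p : ℝ × E} (hp : 0 < ‖p.2‖ ^ 2 + p.1 ^ 2) :
    ContDiffAt ℝ ∞ (fun p : ℝ × E => regPow m p.1 p.2) p := by
  have h1 : ContDiffAt ℝ ∞ (fun p : ℝ × E => ‖p.2‖ ^ 2 + p.1 ^ 2) p :=
    ((contDiff_snd.norm_sq ℝ).add (contDiff_fst.pow 2)).contDiffAt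
  exact (h1.sqrt hp.ne').rpow_const_of_ne (Real.sqrt_pos.2 hp).ne'

theorem continuousAt_iteratedFDeriv_regPow (m : ℝ) (k : ℕ) {p : ℝ × E}
    (hp : 0 < ‖p.2‖ ^ 2 + p.1 ^ 2) :
    ContinuousAt (fun p : ℝ × E => iteratedFDeriv ℝ k (regPow m p.1) p.2) p :=
  (contDiffAt_iteratedFDeriv_of_uncurry (contDiffAt_regPow m hp) k).continuousAt

theorem contDiff_regPow (m : ℝ) {c : ℝ} (hc : c ≠ 0) : ContDiff ℝ ∞ (regPow (E := E) m c) :=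
  contDiff_iff_contDiffAt.2 fun q =>
    ContDiffAt.comp (f := fun q : E => (c, q)) q
      (contDiffAt_regPow (E := E) m (p := (c, q)) (by positivity)) (by fun_prop)

theorem regPow_scale (m c : ℝ) {r : ℝ} (hr : 0 < r) (q : E) :
    regPow m c q = r ^ (-m) * regPow m (r⁻¹ * c) (r⁻¹ • q) := by
  have h : ‖q‖ ^ 2 + c ^ 2 = r ^ 2 * (‖r⁻¹ • q‖ ^ 2 + (r⁻¹ * c) ^ 2) := by
    rw [norm_smul, Real.norm_of_nonneg (inv_pos.2 hr).le]
    field_simp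
  rw [regPow, regPow, h, Real.sqrt_mul (sq_nonneg r), Real.sqrt_sq hr.le,
    Real.mul_rpow hr.le (Real.sqrt_nonneg _)]

/-- The `k`-th derivative of the regularized power `(|q|² + c²)^{-m/2}` is bounded by a multiple,
independent of `c`, of `(|q|² + c²)^{-(m+k)/2}`. -/
theorem exists_norm_iteratedFDeriv_regPow_le [FiniteDimensional ℝ E] (m : ℝ) (k : ℕ) :
    ∃ C : ℝ, 0 < C ∧ ∀ (c : ℝ) (q : E), c ≠ 0 →
      ‖iteratedFDeriv ℝ k (regPow m c) q‖ ≤ C * regPow (m + k) c q := by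
  have : ProperSpace E := FiniteDimensional.proper ℝ E
  let S : Set (ℝ × E) := {p | ‖p.2‖ ^ 2 + p.1 ^ 2 = 1}
  have hS : IsCompact S := by
    refine Metric.isCompact_of_isClosed_isBounded
      (isClosed_eq (by fun_prop) continuous_const) ?_
    refine isBounded_iff_forall_norm_le.2 ⟨1, fun p hp => ?_⟩
    have hp : ‖p.2‖ ^ 2 + p.1 ^ 2 = 1 := hp
    rw [Prod.norm_def, sup_le_iff, Real.norm_eq_abs]
    constructor
    · exact abs_le_one_iff_mul_self_le_one.2 (by nlinarith [sq_nonneg ‖p.2‖])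
    · nlinarith [sq_nonneg p.1, norm_nonneg p.2]
  obtain ⟨C, hC⟩ := hS.exists_bound_of_continuousOn
    (f := fun p : ℝ × E => iteratedFDeriv ℝ k (regPow m p.1) p.2) fun p hp =>
      (continuousAt_iteratedFDeriv_regPow m k
        (by rw [show ‖p.2‖ ^ 2 + p.1 ^ 2 = 1 from hp]; exact one_pos)).continuousWithinAt
  refine ⟨max C 1, by positivity, fun c q hc => ?_⟩
  have hpos : 0 < ‖q‖ ^ 2 + c ^ 2 := by positivity
  set r := Real.sqrt (‖q‖ ^ 2 + c ^ 2) with hr_def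
  have hr : 0 < r := Real.sqrt_pos.2 hpos
  have hr2 : r ^ 2 = ‖q‖ ^ 2 + c ^ 2 := Real.sq_sqrt hpos.le
  have hsc : regPow m c = fun q : E => r ^ (-m) • regPow m (r⁻¹ * c) (r⁻¹ • q) :=
    funext fun q => regPow_scale m c hr q
  have hsm : ContDiff ℝ ∞ (regPow (E := E) m (r⁻¹ * c)) :=
    contDiff_regPow m (mul_ne_zero (inv_pos.2 hr).ne' hc)
  have hk : ContDiff ℝ k (regPow (E := E) m (r⁻¹ * c)) := hsm.of_le (by exact_mod_cast le_top)
  have hmem : (r⁻¹ * c, r⁻¹ • q) ∈ S := by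
    change ‖r⁻¹ • q‖ ^ 2 + (r⁻¹ * c) ^ 2 = 1
    rw [norm_smul, Real.norm_of_nonneg (inv_pos.2 hr).le]
    field_simp
    exact hr2.symm
  rw [hsc, iteratedFDeriv_const_smul_apply' (by fun_prop), iteratedFDeriv_comp_const_smul _ hk,
    norm_smul, norm_smul, Real.norm_of_nonneg (by positivity), Real.norm_of_nonneg (by positivity)]
  have hrp : regPow (m + k) c q = r ^ (-m) * r⁻¹ ^ k := by
    rw [regPow, ← hr_def, neg_add, Real.rpow_add hr, Real.rpow_neg hr.le (k : ℝ),
      Real.rpow_natCast, inv_pow]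
  rw [hrp, ← mul_assoc, mul_comm (max C 1)]
  gcongr
  exact (hC _ hmem).trans (le_max_left _ _)

end RegularizedPower

theorem integral_rpow_neg_le {d q p b : ℝ} (hd : 0 < d) (hq : 0 < q) (hp : 3 / 2 ≤ p)
    (hb0 : 0 ≤ b) (hb : b ≤ 1) :
    IntervalIntegrable (fun t => (d + q * (1 - t)) ^ (-p)) volume 0 b ∧
      q * ∫ t in (0 : ℝ)..b, (d + q * (1 - t)) ^ (-p) ≤ 2 * d ^ (1 - p) := by
  have hpos : ∀ t ∈ Set.uIcc 0 b, 0 < d + q * (1 - t) := fun t ht => by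
    rw [Set.uIcc_of_le hb0] at ht
    have : 0 ≤ q * (1 - t) := mul_nonneg hq.le (by linarith [ht.2])
    linarith
  have hint : IntervalIntegrable (fun t => (d + q * (1 - t)) ^ (-p)) volume 0 b :=
    ContinuousOn.intervalIntegrable
      (ContinuousOn.rpow_const (by fun_prop) fun t ht => Or.inl (hpos t ht).ne')
  refine ⟨hint, ?_⟩
  have hder : ∀ t ∈ Set.uIcc 0 b, HasDerivAt
      (fun t => (d + q * (1 - t)) ^ (1 - p) / (q * (p - 1))) ((d + q * (1 - t)) ^ (-p)) t := by
    intro t ht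
    have h1 : HasDerivAt (fun t => d + q * (1 - t)) (-q) t := by
      simpa using (((hasDerivAt_id t).const_sub 1).const_mul q).const_add d
    have h2 := (h1.rpow_const (p := 1 - p) (Or.inl (hpos t ht).ne')).div_const (q * (p - 1))
    refine h2.congr_deriv ?_
    have : p - 1 ≠ 0 := by linarith
    rw [show 1 - p - 1 = -p by ring]
    field_simp
    ring
  rw [intervalIntegral.integral_eq_sub_of_hasDerivAt hder hint]
  have hb' := hpos b Set.right_mem_uIcc
  have h0 := hpos 0 Set.left_mem_uIcc
  have e : q * ((d + q * (1 - b)) ^ (1 - p) / (q * (p - 1))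
      - (d + q * (1 - 0)) ^ (1 - p) / (q * (p - 1))) =
      ((d + q * (1 - b)) ^ (1 - p) - (d + q * (1 - 0)) ^ (1 - p)) / (p - 1) := by
    field_simp
  rw [e, div_le_iff₀ (by linarith)]
  have m1 : (d + q * (1 - b)) ^ (1 - p) ≤ d ^ (1 - p) :=
    Real.rpow_le_rpow_of_nonpos hd (by nlinarith) (by linarith)
  have m2 := Real.rpow_pos_of_pos h0 (1 - p)
  have m3 := Real.rpow_pos_of_pos hd (1 - p)
  nlinarith

section Green

variable {n : ℕ}

/-- The squared quantity under the root in `greenA`. -/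
theorem greenA_radicand_eq (i : Fin n) (x y : EuclideanSpace ℝ (Fin n)) (θ : ℝ) :
    θ * ‖x - y‖ ^ 2 + (1 - θ) * (‖x - y‖ ^ 2 - (x i - y i) ^ 2 + (x i + y i) ^ 2) =
      ‖x - y‖ ^ 2 + 4 * (x i * y i) * (1 - θ) := by
  ring

/-- The centre with respect to which `greenA` is a regularized distance. -/
noncomputable def greenCenter (i : Fin n) (y : EuclideanSpace ℝ (Fin n)) (θ : ℝ) :
    EuclideanSpace ℝ (Fin n) :=
  y - (2 * (1 - θ) * y i) • EuclideanSpace.single i (1 : ℝ)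

theorem norm_sub_greenCenter_sq (i : Fin n) (x y : EuclideanSpace ℝ (Fin n)) {θ : ℝ}
    (hθ : θ ∈ Set.Icc (0 : ℝ) 1) :
    ‖x - greenCenter i y θ‖ ^ 2 + (2 * Real.sqrt (θ * (1 - θ)) * y i) ^ 2 =
      ‖x - y‖ ^ 2 + 4 * (x i * y i) * (1 - θ) := by
  have h : x - greenCenter i y θ =
      (x - y) + (2 * (1 - θ) * y i) • EuclideanSpace.single i (1 : ℝ) := by
    rw [greenCenter]; abel
  have hs : Real.sqrt (θ * (1 - θ)) ^ 2 = θ * (1 - θ) :=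
    Real.sq_sqrt (mul_nonneg hθ.1 (by linarith [hθ.2]))
  rw [h, norm_add_sq_real, inner_smul_right, EuclideanSpace.inner_single_right, norm_smul,
    PiLp.norm_single, norm_one, mul_one, Real.norm_eq_abs, sq_abs, mul_pow _ (y i),
    mul_pow _ (y i), mul_pow 2 (Real.sqrt _), hs]
  simp only [PiLp.sub_apply, conj_trivial]
  ring

theorem greenF_eq (a : ℝ) (i : Fin n) (x y : EuclideanSpace ℝ (Fin n)) {θ : ℝ}
    (hθ : θ ∈ Set.Icc (0 : ℝ) 1) :
    greenF a i x y θ = ((y i) ^ (a + 1) * (θ * (1 - θ)) ^ (a / 2)) •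
      regPow (a + n) (2 * Real.sqrt (θ * (1 - θ)) * y i) (x - greenCenter i y θ) := by
  rw [greenF, greenA, regPow, greenA_radicand_eq, norm_sub_greenCenter_sq i x y hθ, smul_eq_mul]
  ring

theorem iteratedFDeriv_greenE {a : ℝ} (ha : 0 ≤ a) (i : Fin n) {ε : ℝ}
    (hε : ε ∈ Set.Ioo (0 : ℝ) 1) {x y : EuclideanSpace ℝ (Fin n)} (hx : 0 ≤ x i) (hy : 0 < y i)
    (hxy : x ≠ y) (k : ℕ) :
    iteratedFDeriv ℝ k (fun x => greenE a i ε x y) x = ∫ θ in (0 : ℝ)..(1 - ε),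
      ((y i) ^ (a + 1) * (θ * (1 - θ)) ^ (a / 2)) •
        iteratedFDeriv ℝ k (regPow (a + n) (2 * Real.sqrt (θ * (1 - θ)) * y i))
          (x - greenCenter i y θ) := by
  have hε0 : 0 ≤ 1 - ε := by linarith [hε.2]
  have hsub : Set.Icc 0 (1 - ε) ⊆ Set.Icc (0 : ℝ) 1 := Set.Icc_subset_Icc_right (by linarith [hε.1])
  let w : ℝ → ℝ := fun θ => (y i) ^ (a + 1) * (θ * (1 - θ)) ^ (a / 2)
  let c : ℝ → ℝ := fun θ => 2 * Real.sqrt (θ * (1 - θ)) * y i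
  let g : ℝ → EuclideanSpace ℝ (Fin n) → ℝ := fun θ x =>
    w θ • regPow (a + n) (c θ) (x - greenCenter i y θ)
  let U : Set (EuclideanSpace ℝ (Fin n)) := {y, greenCenter i y 0}ᶜ
  have hU : IsOpen U := (Set.toFinite _).isClosed.isOpen_compl
  have hcont : Continuous (greenCenter i y) := by unfold greenCenter; fun_prop
  have hc : Continuous c := by fun_prop
  have hw : Continuous w := continuous_const.mul
    ((by fun_prop : Continuous fun θ : ℝ => θ * (1 - θ)).rpow_const fun _ => Or.inr (by linarith))
  have hpos : ∀ θ ∈ Set.Icc 0 (1 - ε), ∀ x ∈ U,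
      0 < ‖x - greenCenter i y θ‖ ^ 2 + c θ ^ 2 := by
    intro θ hθ x hx
    rcases hθ.1.eq_or_lt with rfl | h0
    · have : x ≠ greenCenter i y 0 := fun h => hx (by simp [h])
      have := norm_pos_iff.2 (sub_ne_zero.2 this)
      positivity
    · have : 0 < 1 - θ := by linarith [hθ.2, hε.1]
      have : 0 < c θ := by positivity
      positivity
  have hsm : ∀ θ ∈ Set.Icc 0 (1 - ε), ∀ x ∈ U,
      ContDiffAt ℝ ∞ (fun x => regPow (a + n) (c θ) (x - greenCenter i y θ)) x :=
    fun θ hθ x hx => ContDiffAt.comp (f := fun x => (c θ, x - greenCenter i y θ)) x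
      (contDiffAt_regPow (a + n) (p := (c θ, x - greenCenter i y θ)) (hpos θ hθ x hx))
      (by fun_prop)
  have hD : ∀ m : ℕ, ∀ θ ∈ Set.Icc 0 (1 - ε), ∀ x ∈ U, iteratedFDeriv ℝ m (g θ) x =
      w θ • iteratedFDeriv ℝ m (regPow (a + n) (c θ)) (x - greenCenter i y θ) := by
    intro m θ hθ x hx
    rw [iteratedFDeriv_const_smul_apply' ((hsm θ hθ x hx).of_le (by exact_mod_cast le_top)),
      iteratedFDeriv_comp_sub]
  have hxU : x ∈ U := by
    rintro (h | h)
    · exact hxy h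
    · rw [h] at hx
      simp [greenCenter] at hx
      linarith
  have hE : (fun x => greenE a i ε x y) = fun x => ∫ θ in (0 : ℝ)..(1 - ε), g θ x := by
    funext x
    refine intervalIntegral.integral_congr fun θ hθ => ?_
    rw [Set.uIcc_of_le hε0] at hθ
    exact greenF_eq a i x y (hsub hθ)
  have hg : ∀ θ ∈ Set.Icc 0 (1 - ε), ∀ x ∈ U, ContDiffAt ℝ ∞ (g θ) x :=
    fun θ hθ x hx => (contDiffAt_const (c := w θ)).smul (hsm θ hθ x hx)
  rw [hE, iteratedFDeriv_intervalIntegral hε0 hU hg ?_ k hxU]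
  · refine intervalIntegral.integral_congr fun θ hθ => ?_
    rw [Set.uIcc_of_le hε0] at hθ
    exact hD k θ hθ x hxU
  · intro m
    refine ContinuousOn.congr (f := fun p : ℝ × EuclideanSpace ℝ (Fin n) => w p.1 •
      iteratedFDeriv ℝ m (regPow (a + n) (c p.1)) (p.2 - greenCenter i y p.1)) ?_
      fun p hp => hD m p.1 hp.1 p.2 hp.2
    refine (hw.comp continuous_fst).continuousOn.smul fun p hp => ?_
    refine ContinuousAt.continuousWithinAt ?_
    exact ContinuousAt.comp
      (f := fun p : ℝ × EuclideanSpace ℝ (Fin n) => (c p.1, p.2 - greenCenter i y p.1))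
      (continuousAt_iteratedFDeriv_regPow (a + n) m
        (p := (c p.1, p.2 - greenCenter i y p.1)) (hpos p.1 hp.1 p.2 hp.2))
      (by fun_prop)

/-- The weight in the Green kernel absorbs the factor `A^{-a}`. -/
theorem weight_mul_regPow_le {a : ℝ} (ha : 0 ≤ a) (k : ℕ) (i : Fin n)
    {x y : EuclideanSpace ℝ (Fin n)} (hy : 0 < y i) {θ : ℝ} (hθ : θ ∈ Set.Ioo (0 : ℝ) 1) :
    ((y i) ^ (a + 1) * (θ * (1 - θ)) ^ (a / 2)) *
        regPow (a + n + k) (2 * Real.sqrt (θ * (1 - θ)) * y i) (x - greenCenter i y θ) ≤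
      y i * (‖x - y‖ ^ 2 + 4 * (x i * y i) * (1 - θ)) ^ (-(((n : ℝ) + k) / 2)) := by
  have h1 : 0 < 1 - θ := by linarith [hθ.2]
  have h0 : 0 < θ := hθ.1
  have hs : Real.sqrt (θ * (1 - θ)) ^ 2 = θ * (1 - θ) := Real.sq_sqrt (by positivity)
  have hQ := norm_sub_greenCenter_sq i x y (Set.Ioo_subset_Icc_self hθ)
  rw [regPow, hQ]
  set Q := ‖x - y‖ ^ 2 + 4 * (x i * y i) * (1 - θ)
  have hle : y i ^ 2 * (θ * (1 - θ)) ≤ Q := by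
    rw [← hQ, mul_pow, mul_pow, hs]
    have : 0 < y i ^ 2 * (θ * (1 - θ)) := by positivity
    nlinarith [sq_nonneg ‖x - greenCenter i y θ‖]
  have hQpos : 0 < Q := lt_of_lt_of_le (by positivity) hle
  have hw : (y i) ^ (a + 1) * (θ * (1 - θ)) ^ (a / 2) ≤ y i * Q ^ (a / 2) := by
    have e : (y i) ^ (a + 1) * (θ * (1 - θ)) ^ (a / 2) =
        y i * (y i ^ 2 * (θ * (1 - θ))) ^ (a / 2) := by
      rw [Real.mul_rpow (x := y i ^ 2) (by positivity) (by positivity), ← Real.rpow_natCast,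
        ← Real.rpow_mul hy.le, Real.rpow_add_one hy.ne']
      push_cast
      rw [mul_div_cancel₀ a two_ne_zero]
      ring
    rw [e]
    gcongr
  calc _ ≤ y i * Q ^ (a / 2) * Real.sqrt Q ^ (-(a + n + k)) := by gcongr
    _ = y i * Q ^ (-(((n : ℝ) + k) / 2)) := by
      rw [Real.sqrt_eq_rpow, ← Real.rpow_mul hQpos.le, mul_assoc, ← Real.rpow_add hQpos]
      congr 2
      ring

end Green

/-- For `n ≥ 2`, `a ≥ 1` and an integer `k ≥ 1` there is `C_k = C(n,a,k)`
such that for every `ε ∈ (0,1)` and all `x ≠ y` in the closed upper half-space,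
`xₙ · ‖Dₓᵏ E^ε(x,y)‖ ≤ C_k |x−y|^{2−n−k}`. -/
theorem stmt_6 (n : ℕ) (hn : 2 ≤ n) (a : ℝ) (ha : 1 ≤ a) (k : ℕ) (hk : 1 ≤ k) :
    ∃ C : ℝ, 0 < C ∧
      ∀ ε ∈ Set.Ioo (0 : ℝ) 1, ∀ x y : EuclideanSpace ℝ (Fin n),
        0 ≤ x ⟨n - 1, by omega⟩ → 0 ≤ y ⟨n - 1, by omega⟩ → x ≠ y →
        x ⟨n - 1, by omega⟩ *
            ‖iteratedFDeriv ℝ k (fun x => greenE a ⟨n - 1, by omega⟩ ε x y) x‖ ≤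
          C * ‖x - y‖ ^ ((2 : ℝ) - n - k) := by
  obtain ⟨C, hC0, hC⟩ := exists_norm_iteratedFDeriv_regPow_le
    (E := EuclideanSpace ℝ (Fin n)) (a + n) k
  refine ⟨C, hC0, fun ε hε x y hx hy hxy => ?_⟩
  generalize (⟨n - 1, by omega⟩ : Fin n) = i at hx hy ⊢
  have hd : 0 < ‖x - y‖ := norm_pos_iff.2 (sub_ne_zero.2 hxy)
  rcases hx.eq_or_lt with hx0 | hx0
  · rw [← hx0, zero_mul]
    positivity
  rcases hy.eq_or_lt with hy0 | hy0
  · have : (fun x => greenE a i ε x y) = fun _ => 0 := by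
      funext x
      simp [greenE, greenF, ← hy0, Real.zero_rpow (by linarith : a + 1 ≠ 0)]
    rw [this, iteratedFDeriv_fun_zero]
    simp only [Pi.zero_apply, norm_zero, mul_zero]
    positivity
  have hε0 : 0 ≤ 1 - ε := by linarith [hε.2]
  have hnk : (3 : ℝ) ≤ n + k := by exact_mod_cast Nat.add_le_add hn hk
  obtain ⟨hint, hle⟩ := integral_rpow_neg_le (d := ‖x - y‖ ^ 2) (q := 4 * (x i * y i))
    (p := ((n : ℝ) + k) / 2) (by positivity) (by positivity) (by linarith) hε0
    (by linarith [hε.1])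
  have hbound : ‖iteratedFDeriv ℝ k (fun x => greenE a i ε x y) x‖ ≤
      ∫ θ in (0 : ℝ)..(1 - ε), C * y i *
        (‖x - y‖ ^ 2 + 4 * (x i * y i) * (1 - θ)) ^ (-(((n : ℝ) + k) / 2)) := by
    rw [iteratedFDeriv_greenE (by linarith) i hε hx hy0 hxy k]
    refine intervalIntegral.norm_integral_le_of_norm_le hε0 (.of_forall fun θ hθ => ?_)
      (hint.const_mul _)
    have hθ1 : 0 < 1 - θ := by linarith [hθ.2, hε.1]
    have hθ0 : 0 < θ := hθ.1
    rw [norm_smul, Real.norm_of_nonneg (by positivity)]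
    refine (mul_le_mul_of_nonneg_left (hC _ _ (by positivity)) (by positivity)).trans ?_
    rw [mul_left_comm, mul_assoc C]
    exact mul_le_mul_of_nonneg_left
      (weight_mul_regPow_le (by linarith) k i hy0 ⟨hθ0, by linarith⟩) hC0.le
  rw [intervalIntegral.integral_const_mul] at hbound
  have hpow : (‖x - y‖ ^ 2) ^ (1 - ((n : ℝ) + k) / 2) = ‖x - y‖ ^ ((2 : ℝ) - n - k) := by
    rw [← Real.rpow_natCast, ← Real.rpow_mul hd.le]
    congr 1
    push_cast
    ring
  rw [hpow] at hle
  have hp : 0 < ‖x - y‖ ^ ((2 : ℝ) - n - k) := by positivity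
  refine (mul_le_mul_of_nonneg_left hbound hx).trans ?_
  nlinarith [mul_le_mul_of_nonneg_left hle hC0.le, mul_pos hC0 hp]
end

section
/- Let T > 0, C > 0 and M > 0, and let y : [0,T] → ℝ be differentiable with y(0) = 0 and 0 ≤ y(t) ≤ M² for all t ∈ [0,T]. Assume that for every real number p ≥ 3 and every t ∈ [0,T] one has y'(t) ≤ p · C · M^{2/p} · y(t)^{1 − 1/p}. Then y(t) = 0 for every t ∈ [0,T]. -/
/-- The barrier value `B = M² e^{-p}` turns the exponent-`p` bound into a multiple of `B`. -/
theorem rpow_mul_barrier_rpow {M p : ℝ} (hM : 0 < M) (hp : 0 < p) :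
    M ^ (2 / p) * (M ^ 2 * Real.exp (-p)) ^ (1 - 1 / p) =
      Real.exp 1 * (M ^ 2 * Real.exp (-p)) := by
  obtain ⟨m, rfl⟩ : ∃ m, M = Real.exp m := ⟨Real.log M, (Real.exp_log hM).symm⟩
  rw [← Real.exp_nat_mul, ← Real.exp_add, ← Real.exp_mul, ← Real.exp_mul, ← Real.exp_add,
    ← Real.exp_add]
  congr 1
  push_cast
  field_simp
  ring

/-- A double exponential barrier for the Osgood inequality. -/
theorem le_double_exp_barrier {T C M L : ℝ} (hC : 0 < C) (hM : 0 < M)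
    (hL : 3 * Real.exp (3 * C * T) ≤ L) {y y' : ℝ → ℝ}
    (hderiv : ∀ t ∈ Set.Icc (0 : ℝ) T, HasDerivWithinAt y (y' t) (Set.Icc (0 : ℝ) T) t)
    (h0 : y 0 = 0)
    (hineq : ∀ p : ℝ, 3 ≤ p → ∀ t ∈ Set.Icc (0 : ℝ) T,
      y' t ≤ p * C * M ^ (2 / p) * y t ^ (1 - 1 / p)) :
    ∀ t ∈ Set.Icc (0 : ℝ) T, y t ≤ M ^ 2 * Real.exp (-(L * Real.exp (-(3 * C * t)))) := by
  have hB (t : ℝ) : HasDerivAt (fun t => M ^ 2 * Real.exp (-(L * Real.exp (-(3 * C * t)))))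
      (L * Real.exp (-(3 * C * t)) * (3 * C) *
        (M ^ 2 * Real.exp (-(L * Real.exp (-(3 * C * t)))))) t := by
    refine (((((hasDerivAt_id' t).const_mul (3 * C)).neg.exp.const_mul
      L).neg.exp).const_mul (M ^ 2)).congr_deriv ?_
    simp only [Pi.neg_apply]
    ring
  refine fun t ht => image_le_of_deriv_right_lt_deriv_boundary
    (fun s hs => (hderiv s hs).continuousWithinAt)
    (fun s hs => (hderiv s (Set.Ico_subset_Icc_self hs)).mono_of_mem_nhdsWithin
      (Icc_mem_nhdsGE_of_mem hs)) (by rw [h0]; positivity) hB (fun s hs hys => ?_) ht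
  have hp : 3 ≤ L * Real.exp (-(3 * C * s)) := by
    have hs' : Real.exp (3 * C * s) ≤ Real.exp (3 * C * T) := by
      have := hs.2.le
      gcongr
    rw [Real.exp_neg, ← div_eq_mul_inv, le_div_iff₀ (Real.exp_pos _)]
    linarith
  have hy := hineq _ hp s (Set.Ico_subset_Icc_self hs)
  generalize L * Real.exp (-(3 * C * s)) = p at *
  have hp0 : 0 < p := by linarith
  rw [hys, mul_assoc, rpow_mul_barrier_rpow hM hp0] at hy
  have hpos : 0 < p * C * (M ^ 2 * Real.exp (-p)) := by positivity
  nlinarith [mul_lt_mul_of_pos_left Real.exp_one_lt_three hpos]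


/-- Yudovich-type Osgood argument. Let `T, C, M > 0` and let
`y : [0,T] → ℝ` be differentiable (with derivative `y'`), `y 0 = 0`,
`0 ≤ y t ≤ M²` on `[0,T]`. If for every real `p ≥ 3` and every `t ∈ [0,T]` one has
`y'(t) ≤ p·C·M^{2/p}·y(t)^{1−1/p}`, then `y ≡ 0` on `[0,T]`. -/
theorem stmt_12 (T C M : ℝ) (hT : 0 < T) (hC : 0 < C) (hM : 0 < M)
    (y y' : ℝ → ℝ)
    (hderiv : ∀ t ∈ Set.Icc (0 : ℝ) T, HasDerivWithinAt y (y' t) (Set.Icc (0 : ℝ) T) t)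
    (h0 : y 0 = 0)
    (hnonneg : ∀ t ∈ Set.Icc (0 : ℝ) T, 0 ≤ y t)
    (hbdd : ∀ t ∈ Set.Icc (0 : ℝ) T, y t ≤ M ^ 2)
    (hineq : ∀ p : ℝ, 3 ≤ p → ∀ t ∈ Set.Icc (0 : ℝ) T,
      y' t ≤ p * C * M ^ (2 / p) * y t ^ (1 - 1 / p)) :
    ∀ t ∈ Set.Icc (0 : ℝ) T, y t = 0 := by
  intro t ht
  refine le_antisymm (ge_of_tendsto (x := Filter.atTop)
    (f := fun L : ℝ => M ^ 2 * Real.exp (-(L * Real.exp (-(3 * C * t))))) ?_ ?_) (hnonneg t ht)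
  · simpa using (Real.tendsto_exp_neg_atTop_nhds_zero.comp
      (Filter.tendsto_id.atTop_mul_const (Real.exp_pos (-(3 * C * t))))).const_mul (M ^ 2)
  · filter_upwards [Filter.eventually_ge_atTop (3 * Real.exp (3 * C * T))] with L hL
    exact le_double_exp_barrier hC hM hL hderiv h0 hineq t ht
end
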